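/- Let n ≥ 3. Suppose P is a nonzero orthogonal projection on (ℂ²)^{⊗n} such that for every x ∈ F₂^{2n+1} with wt(x) = 2 there exists ε ∈ ℂ with P Γ_x P = ε P (i.e., P is an 𝔰𝔬(2n+1) spinorial code of minimum distance at least 2). Then (n + 1) · rank P ≤ 2^{n−1}. -/

import Mathlib

noncomputable section

open Matrix

/-- The Pauli matrix `σ_x`. -/
def pauliX : Matrix (Fin 2) (Fin 2) ℂ := !![0, 1; 1, 0]

/-- The Pauli matrix `σ_y`. -/
def pauliY : Matrix (Fin 2) (Fin 2) ℂ := !![0, -Complex.I; Complex.I, 0]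

/-- The Pauli matrix `σ_z`. -/
def pauliZ : Matrix (Fin 2) (Fin 2) ℂ := !![1, 0; 0, -1]

/-- The single-site factor of the `k`-th Weyl–Brauer matrix (with `k` 1-based and
site `i` 0-based): for `1 ≤ k ≤ n` it is `σ_z` on sites before site `k`, `σ_x` at
site `k`, and the identity afterwards; for `n+1 ≤ k ≤ 2n` the same with `σ_y` at site
`k - n`; and for `k = 2n+1` it is `σ_z` everywhere. -/
def wbFactor (n k i : ℕ) : Matrix (Fin 2) (Fin 2) ℂ :=
  if k ≤ n then (if i + 1 < k then pauliZ else if i + 1 = k then pauliX else 1)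
  else if k ≤ 2 * n then
    (if i + 1 < k - n then pauliZ else if i + 1 = k - n then pauliY else 1)
  else pauliZ

/-- The `k`-th Weyl–Brauer matrix on `(ℂ²)^{⊗n}` (with `k` 1-based, `1 ≤ k ≤ 2n+1`),
realized as a matrix indexed by `Fin n → Fin 2`:
`U_k = σ_z^{⊗(k−1)} ⊗ σ_x ⊗ I₂^{⊗(n−k)}`, `U_{n+k} = σ_z^{⊗(k−1)} ⊗ σ_y ⊗ I₂^{⊗(n−k)}`
for `1 ≤ k ≤ n`, and `U_{2n+1} = σ_z^{⊗n}`. -/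
def weylBrauer (n k : ℕ) : Matrix (Fin n → Fin 2) (Fin n → Fin 2) ℂ :=
  Matrix.of fun a b => ∏ i : Fin n, wbFactor n k (i : ℕ) (a i) (b i)

/-- The Hamming weight of a binary vector: the number of nonzero components. -/
def wtZ {l : ℕ} (x : Fin l → ZMod 2) : ℕ :=
  (Finset.filter (fun i => x i ≠ 0) Finset.univ).card

/-- `τ(x) = wt(x)(wt(x) − 1)/2`. -/
def tauZ {l : ℕ} (x : Fin l → ZMod 2) : ℕ := wtZ x * (wtZ x - 1) / 2

/-- The `k`-th (0-based) component of `x` as a natural number (`0` or `1`), with the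
convention that it is `0` out of range. -/
def xcomp {l : ℕ} (x : Fin l → ZMod 2) (k : ℕ) : ℕ :=
  if h : k < l then (x ⟨k, h⟩).val else 0

/-- The Clifford operator `Γ_x` on `(ℂ²)^{⊗n}` for `x ∈ F₂^l`, intended for `l = 2n`
(even case) or `l = 2n+1` (odd case):
`Γ_x = i^{τ(x)} (∏_{k=1}^{n} U_k^{x_k} U_{n+k}^{x_{n+k}}) U_{2n+1}^{x_{2n+1}}`,
the product taken over `k` in increasing order, where the final factor
`U_{2n+1}^{x_{2n+1}}` is `1` when `l = 2n`. -/
def gammaOp (n l : ℕ) (x : Fin l → ZMod 2) : Matrix (Fin n → Fin 2) (Fin n → Fin 2) ℂ :=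
  (Complex.I ^ tauZ x) •
    ((((List.finRange n).map fun k =>
        weylBrauer n ((k : ℕ) + 1) ^ xcomp x (k : ℕ) *
          weylBrauer n (n + (k : ℕ) + 1) ^ xcomp x (n + (k : ℕ))).prod) *
      weylBrauer n (2 * n + 1) ^ xcomp x (2 * n))

def tens {n : ℕ} (f : Fin n → Matrix (Fin 2) (Fin 2) ℂ) :
    Matrix (Fin n → Fin 2) (Fin n → Fin 2) ℂ :=
  Matrix.of fun a b => ∏ i : Fin n, f i (a i) (b i)

theorem tens_mul {n : ℕ} (f g : Fin n → Matrix (Fin 2) (Fin 2) ℂ) :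
    tens f * tens g = tens (fun i => f i * g i) := by
  ext a b
  simp only [tens, Matrix.mul_apply, Matrix.of_apply]
  rw [Fintype.prod_sum]
  simp only [Finset.prod_mul_distrib]

theorem tens_one {n : ℕ} : tens (fun _ : Fin n => (1 : Matrix (Fin 2) (Fin 2) ℂ)) = 1 := by
  ext a b
  simp only [tens, Matrix.of_apply, Matrix.one_apply, Finset.prod_ite_zero]
  simp [funext_iff]

theorem tens_conj {n : ℕ} (f : Fin n → Matrix (Fin 2) (Fin 2) ℂ) :
    (tens f)ᴴ = tens (fun i => (f i)ᴴ) := by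
  ext a b
  simp [tens, Matrix.conjTranspose_apply]

theorem tens_neg {n : ℕ} (f g : Fin n → Matrix (Fin 2) (Fin 2) ℂ) (i₀ : Fin n)
    (h0 : f i₀ = - g i₀) (h : ∀ i, i ≠ i₀ → f i = g i) : tens f = - tens g := by
  ext a b
  simp only [tens, Matrix.of_apply, Matrix.neg_apply]
  rw [← Finset.mul_prod_erase _ _ (Finset.mem_univ i₀),
    ← Finset.mul_prod_erase (a := i₀) _ (fun i => g i (a i) (b i)) (Finset.mem_univ i₀), h0,
    Matrix.neg_apply, neg_mul]
  congr 2
  refine Finset.prod_congr rfl fun i hi => ?_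
  rw [h i (Finset.ne_of_mem_erase hi)]

theorem wb_eq (n k : ℕ) : weylBrauer n k = tens (fun i : Fin n => wbFactor n k i) := rfl

theorem pXX : pauliX * pauliX = 1 := by
  ext i j; fin_cases i <;> fin_cases j <;> simp [pauliX, Matrix.mul_apply, Fin.sum_univ_two]
theorem pYY : pauliY * pauliY = 1 := by
  ext i j; fin_cases i <;> fin_cases j <;> simp [pauliY, Matrix.mul_apply, Fin.sum_univ_two]
theorem pZZ : pauliZ * pauliZ = 1 := by
  ext i j; fin_cases i <;> fin_cases j <;> simp [pauliZ, Matrix.mul_apply, Fin.sum_univ_two]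
theorem pXZ : pauliX * pauliZ = -(pauliZ * pauliX) := by
  ext i j; fin_cases i <;> fin_cases j <;> simp [pauliX, pauliZ, Matrix.mul_apply, Fin.sum_univ_two]
theorem pYZ : pauliY * pauliZ = -(pauliZ * pauliY) := by
  ext i j; fin_cases i <;> fin_cases j <;> simp [pauliY, pauliZ, Matrix.mul_apply, Fin.sum_univ_two]
theorem pXY : pauliX * pauliY = -(pauliY * pauliX) := by
  ext i j; fin_cases i <;> fin_cases j <;> simp [pauliY, pauliX, Matrix.mul_apply, Fin.sum_univ_two]
theorem pXh : pauliXᴴ = pauliX := by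
  ext i j; fin_cases i <;> fin_cases j <;> simp [pauliX]
theorem pYh : pauliYᴴ = pauliY := by
  ext i j; fin_cases i <;> fin_cases j <;> simp [pauliY]
theorem pZh : pauliZᴴ = pauliZ := by
  ext i j; fin_cases i <;> fin_cases j <;> simp [pauliZ]

theorem wb_herm (n k : ℕ) : (weylBrauer n k)ᴴ = weylBrauer n k := by
  rw [wb_eq, tens_conj]
  congr 1
  funext i
  unfold wbFactor
  split_ifs <;> simp [pXh, pYh, pZh]

theorem wb_sq (n k : ℕ) : weylBrauer n k * weylBrauer n k = 1 := by
  rw [wb_eq, tens_mul, ← tens_one]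
  congr 1
  funext i
  unfold wbFactor
  split_ifs <;> simp [pXX, pYY, pZZ]

/-- 0-based site of the Weyl–Brauer matrix with 0-based index `k`. -/
def wbPos (n k : ℕ) : ℕ := if k < n then k else k - n

/-- The letter at that site. -/
def wbLet (n k : ℕ) : Matrix (Fin 2) (Fin 2) ℂ := if k < n then pauliX else pauliY

theorem wbFactor_eq (n k i : ℕ) (hk : k < 2 * n + 1) (hi : i < n) :
    wbFactor n (k + 1) i = if i < wbPos n k then pauliZ else if i = wbPos n k then wbLet n k else 1 := by
  unfold wbFactor wbPos wbLet
  split_ifs <;> first | rfl | omega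

theorem wbLet_Z (n k : ℕ) : wbLet n k * pauliZ = -(pauliZ * wbLet n k) := by
  unfold wbLet
  split_ifs
  · exact pXZ
  · exact pYZ

theorem wb_anti_aux (n j k : ℕ) (hj : j < 2 * n + 1) (hk : k < 2 * n + 1)
    (hle : wbPos n j < wbPos n k ∨ (wbPos n j = wbPos n k ∧ j < k)) :
    weylBrauer n (j + 1) * weylBrauer n (k + 1) = -(weylBrauer n (k + 1) * weylBrauer n (j + 1)) := by
  have hpos : wbPos n j < n := by
    unfold wbPos at *; split_ifs at * <;> omega
  rw [wb_eq, wb_eq, tens_mul, tens_mul]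
  apply tens_neg _ _ ⟨wbPos n j, hpos⟩
  · simp only
    rw [wbFactor_eq n j _ hj hpos, wbFactor_eq n k _ hk hpos]
    rcases hle with h | ⟨h, h'⟩
    · simp only [h, lt_irrefl, if_true, if_false]
      exact wbLet_Z n j
    · rw [← h]
      simp only [lt_irrefl, if_true, if_false]
      have a1 : j < n := by unfold wbPos at h; split_ifs at h <;> omega
      have a2 : ¬ k < n := by unfold wbPos at h; split_ifs at h <;> omega
      simp only [wbLet, a1, a2, if_true, if_false]
      exact pXY
  · intro i hi
    have hi' : (i : ℕ) ≠ wbPos n j := fun h => hi (Fin.ext h)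
    rw [wbFactor_eq n j _ hj i.2, wbFactor_eq n k _ hk i.2]
    rcases lt_or_gt_of_ne hi' with h | h
    · have : (i : ℕ) < wbPos n k := by omega
      simp [h, this]
    · simp [h.not_gt, h.ne']

theorem wb_anti (n j k : ℕ) (hj : j < 2 * n + 1) (hk : k < 2 * n + 1) (hjk : j ≠ k) :
    weylBrauer n (j + 1) * weylBrauer n (k + 1) = -(weylBrauer n (k + 1) * weylBrauer n (j + 1)) := by
  have : (wbPos n j < wbPos n k ∨ (wbPos n j = wbPos n k ∧ j < k)) ∨
    (wbPos n k < wbPos n j ∨ (wbPos n k = wbPos n j ∧ k < j)) := by omega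
  rcases this with h | h
  · exact wb_anti_aux n j k hj hk h
  · rw [wb_anti_aux n k j hk hj h, neg_neg]

/-- order of the indices in the product -/
def idxList (n : ℕ) : List ℕ := ((List.range n).flatMap fun k => [k, n + k]) ++ [2 * n]

theorem gammaOp_eq (n l : ℕ) (x : Fin l → ZMod 2) : gammaOp n l x = (Complex.I ^ tauZ x) •
    ((idxList n).map fun k => weylBrauer n (k + 1) ^ xcomp x k).prod := by
  have hr : (do let a ← List.finRange n; pure (a : ℕ)) = List.range n := by
    rw [← List.map_coe_finRange_eq_range]
    simp [List.map_eq_flatMap]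
  unfold gammaOp idxList
  rw [List.map_append, List.prod_append, hr]
  congr 2
  · induction List.range n with
    | nil => simp
    | cons a t ih =>
      rw [List.map_cons, List.prod_cons, ih, List.flatMap_cons, List.map_append, List.prod_append]
      simp
  · simp

theorem idxList_nodup (n : ℕ) : (idxList n).Nodup := by
  unfold idxList
  rw [List.nodup_append]
  refine ⟨?_, by simp, ?_⟩
  · rw [List.nodup_flatMap]
    refine ⟨fun k hk => ?_, ?_⟩
    · have := List.mem_range.1 hk
      simp; omega
    · refine (List.nodup_range (n := n)).imp_of_mem ?_
      intro a b ha hb hab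
      have h1 := List.mem_range.1 ha
      have h2 := List.mem_range.1 hb
      have h3 : a ≠ b := hab
      simp [Function.onFun, List.disjoint_left]
      omega
  · intro a ha b hb
    simp only [List.mem_flatMap, List.mem_range, List.mem_cons, List.not_mem_nil,
      or_false] at ha hb
    obtain ⟨k, hk, hk'⟩ := ha
    omega

theorem mem_idxList (n k : ℕ) (hk : k < 2 * n + 1) : k ∈ idxList n := by
  unfold idxList
  simp only [List.mem_append, List.mem_flatMap, List.mem_range, List.mem_cons,
    List.not_mem_nil, or_false]
  by_cases h1 : k < n
  · exact Or.inl ⟨k, h1, Or.inl rfl⟩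
  · by_cases h2 : k < 2 * n
    · exact Or.inl ⟨k - n, by omega, Or.inr (by omega)⟩
    · right; omega

theorem prod_filter_pow {M : Type*} [Monoid M] (W : ℕ → M) (y : ℕ → ℕ) (L : List ℕ)
    (q : ℕ → Bool) (hy : ∀ k, y k = if q k then 1 else 0) :
    (L.map fun k => W k ^ y k).prod = ((L.filter q).map W).prod := by
  induction L with
  | nil => simp
  | cons a t ih =>
    rw [List.map_cons, List.prod_cons, ih, hy]
    cases h : q a <;> simp [h]

theorem gamma_pair (n : ℕ) (a b : Fin (2 * n + 1)) (hab : a < b) :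
    ∃ (x : Fin (2 * n + 1) → ZMod 2) (c : ℂ), wtZ x = 2 ∧
      weylBrauer n (a + 1) * weylBrauer n (b + 1) = c • gammaOp n (2 * n + 1) x := by
  let x : Fin (2 * n + 1) → ZMod 2 := fun i => if i = a ∨ i = b then 1 else 0
  have hw : wtZ x = 2 := by
    unfold wtZ
    have : (Finset.filter (fun i => x i ≠ 0) Finset.univ) = {a, b} := by
      ext i; simp [x]; tauto
    rw [this, Finset.card_pair hab.ne]
  have hab' : (a : ℕ) < b := hab
  have hL : (idxList n).filter (fun k : ℕ => decide (k = a.1 ∨ k = b.1)) = [(a : ℕ), (b : ℕ)] ∨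
      (idxList n).filter (fun k : ℕ => decide (k = a.1 ∨ k = b.1)) = [(b : ℕ), (a : ℕ)] := by
    have hp : ((idxList n).filter (fun k : ℕ => decide (k = a.1 ∨ k = b.1))).Perm [(a : ℕ), (b : ℕ)] := by
      rw [List.perm_ext_iff_of_nodup ((idxList_nodup n).filter _) (by simp; omega)]
      intro k
      simp only [List.mem_filter, decide_eq_true_eq, List.mem_cons, List.not_mem_nil, or_false]
      refine ⟨fun h => h.2, fun h => ⟨mem_idxList n k ?_, h⟩⟩
      rcases h with h | h
      · rw [h]; exact a.2
      · rw [h]; exact b.2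
    have hlen := hp.length_eq
    generalize (idxList n).filter (fun k : ℕ => decide (k = a.1 ∨ k = b.1)) = L at hp hlen
    match L, hlen with
    | [u, v], _ =>
      have hnd := hp.nodup_iff.2 (by simp; omega)
      have hu := hp.mem_iff (a := u)
      have hv := hp.mem_iff (a := v)
      simp at hu hv hnd
      rcases hu with hu | hu <;> rcases hv with hv | hv
      · omega
      · left; rw [hu, hv]
      · right; rw [hu, hv]
      · omega
  have hg : gammaOp n (2 * n + 1) x = Complex.I •
      (((idxList n).filter (fun k : ℕ => decide (k = a.1 ∨ k = b.1))).map
        (fun k => weylBrauer n (k + 1))).prod := by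
    rw [gammaOp_eq, prod_filter_pow (fun k => weylBrauer n (k + 1)) (xcomp x) (idxList n)
      (fun k : ℕ => decide (k = a.1 ∨ k = b.1))]
    · unfold tauZ; rw [hw]; norm_num
    · intro k
      unfold xcomp
      split_ifs with h1 h2 h2
      · have : x ⟨k, h1⟩ = 1 := by
          have h2' : k = a.1 ∨ k = b.1 := by simpa using h2
          simp only [x, Fin.ext_iff]; exact if_pos h2'
        rw [this]; rfl
      · have : x ⟨k, h1⟩ = 0 := by
          have h2' : ¬ (k = a.1 ∨ k = b.1) := by simpa using h2
          simp only [x, Fin.ext_iff]; exact if_neg h2'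
        rw [this]; rfl
      · simp at h2; have := a.2; have := b.2; omega
      · rfl
  rcases hL with h | h
  · refine ⟨x, -Complex.I, hw, ?_⟩
    rw [hg, h, smul_smul]
    simp
  · refine ⟨x, Complex.I, hw, ?_⟩
    rw [hg, h, smul_smul, wb_anti n a b a.2 b.2 (by omega)]
    simp

theorem final_arith (n r : ℕ) (E : ℝ) (hn : 3 ≤ n) (hE : 0 ≤ E) (hr : 0 < r)
    (h : (r : ℝ) ^ 2 * (2 * n * (n + 1) + 2 * (n - 1) * (n - 2) * E) ≤ (2:ℝ) ^ n * (r * (E + n))) :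
    (n + 1) * r ≤ 2 ^ (n - 1) := by
  have hr' : (0:ℝ) < r := by exact_mod_cast hr
  have h1 : (r : ℝ) * (2 * n * (n + 1) + 2 * (n - 1) * (n - 2) * E) ≤ (2:ℝ) ^ n * (E + n) := by
    refine le_of_mul_le_mul_left ?_ hr'
    calc _ = (r : ℝ) ^ 2 * (2 * n * (n + 1) + 2 * (n - 1) * (n - 2) * E) := by ring
      _ ≤ _ := h
      _ = _ := by ring
  rcases Nat.lt_or_ge 3 n with hn4 | hn3
  · by_contra hcon
    push Not at hcon
    have hc : (2:ℝ) ^ (n - 1) < (n + 1) * r := by exact_mod_cast hcon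
    have hp : (2:ℝ) ^ n = 2 * 2 ^ (n - 1) := by
      rw [← pow_succ']; congr 1; omega
    rw [hp] at h1
    have hn' : (4:ℝ) ≤ n := by exact_mod_cast hn4
    have h2 : 2 * (2:ℝ) ^ (n - 1) * (E + n) < 2 * ((n + 1) * r) * (E + n) := by
      have : 0 < E + n := by linarith
      have := mul_lt_mul_of_pos_right hc this
      linarith
    have h3 : (0:ℝ) ≤ (n - 1) * (n - 2) - (n + 1) := by nlinarith
    nlinarith [mul_nonneg (mul_nonneg hr'.le hE) h3]
  · have : n = 3 := by omega
    subst this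
    by_contra hcon
    push Not at hcon
    have h2 : (2:ℝ) ≤ r := by
      have : 2 ≤ r := by omega
      exact_mod_cast this
    norm_num at h1
    nlinarith [mul_nonneg (sub_nonneg.2 h2) hE]


theorem aux_gap {E ι : Type*} [NormedAddCommGroup E] [InnerProductSpace ℂ E] [DecidableEq ι]
    (C : ι → E →ₗ[ℂ] E) (hsym : ∀ a, (C a).IsSymmetric) (hinv : ∀ a x, C a (C a x) = x)
    (hcomm : ∀ a b x, C a (C b x) = C b (C a x)) (s : Finset ι) :
    ∀ k : ℤ, Odd ((s.card : ℤ) + k) → ∀ x : E, ‖x‖ ^ 2 ≤ ‖∑ a ∈ s, C a x + (k : ℂ) • x‖ ^ 2 := by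
  induction s using Finset.induction_on with
  | empty =>
    intro k hk x
    simp only [Finset.card_empty, Nat.cast_zero, zero_add, Finset.sum_empty] at *
    rw [norm_smul, mul_pow]
    have h1 : (1:ℝ) ≤ ‖(k:ℂ)‖ := by
      rw [Complex.norm_intCast]
      have : k ≠ 0 := by rintro rfl; simp at hk
      exact_mod_cast Int.one_le_abs this
    exact le_mul_of_one_le_left (sq_nonneg _) (one_le_pow₀ h1)
  | insert a s ha ih =>
    intro k hk x
    rw [Finset.card_insert_of_notMem ha] at hk
    push_cast at hk
    have orth : ∀ u v : E, C a u = u → C a v = -v → ‖u + v‖ ^ 2 = ‖u‖ ^ 2 + ‖v‖ ^ 2 := by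
      intro u v hu hv
      have h := hsym a u v
      rw [hu, hv, inner_neg_right] at h
      have h0 : inner ℂ u v = 0 := by linear_combination h / 2
      rw [sq, sq, sq]
      exact norm_add_sq_eq_norm_sq_add_norm_sq_of_inner_eq_zero u v h0
    set u : E := (1/2 : ℂ) • (x + C a x) with hu
    set v : E := (1/2 : ℂ) • (x - C a x) with hv
    have hCu : C a u = u := by
      simp only [hu, map_smul, map_add, hinv]; rw [add_comm]
    have hCv : C a v = -v := by
      simp only [hv, map_smul, map_sub, hinv]; rw [← smul_neg, neg_sub]
    have hx : x = u + v := by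
      rw [hu, hv, ← smul_add]; module
    have hCx : C a x = u - v := by
      rw [hu, hv, ← smul_sub]; module
    have e1 : ∑ b ∈ insert a s, C b x + (k : ℂ) • x
        = (∑ b ∈ s, C b u + ((k + 1 : ℤ) : ℂ) • u) + (∑ b ∈ s, C b v + ((k - 1 : ℤ) : ℂ) • v) := by
      rw [Finset.sum_insert ha, hCx]
      have : ∀ b, C b x = C b u + C b v := by intro b; rw [← map_add, ← hx]
      simp only [this, Finset.sum_add_distrib]
      have hkx : (k : ℂ) • x = (k : ℂ) • u + (k : ℂ) • v := by rw [← smul_add, ← hx]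
      rw [hkx]
      push_cast
      module
    rw [e1, orth _ _ ?_ ?_]
    · have i1 := ih (k+1) (by convert hk using 1; ring) u
      have i2 := ih (k-1) (by
        have : ((s.card:ℤ) + (k - 1)) = (s.card + 1 + k) - 2 := by ring
        rw [this]; exact hk.sub_even even_two) v
      calc ‖x‖ ^ 2 = ‖u‖ ^ 2 + ‖v‖ ^ 2 := by rw [hx]; exact orth u v hCu hCv
        _ ≤ _ := add_le_add i1 i2
    · simp only [map_add, map_sum, map_smul, hCu]
      congr 1
      refine Finset.sum_congr rfl fun b _ => ?_
      rw [hcomm, hCu]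
    · simp only [map_add, map_sum, map_smul, hCv, neg_add, ← Finset.sum_neg_distrib, smul_neg]
      congr 1
      refine Finset.sum_congr rfl fun b _ => ?_
      rw [hcomm, hCv, map_neg]

theorem aux_bessel {E J : Type*} [NormedAddCommGroup E] [InnerProductSpace ℂ E] [Fintype J]
    (S : E →ₗ[ℂ] E) (hS : S.IsSymmetric) (hgap : ∀ x, ‖x‖ ^ 2 ≤ ‖S x‖ ^ 2)
    (e : J → E) (he : Orthonormal ℂ e) (c : J → ℝ)
    (hSe : ∀ j, S (e j) = (c j : ℂ) • e j) (x : E) :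
    ∑ j, (c j ^ 2 - 1) * ‖inner ℂ (e j) x‖ ^ 2 ≤ ‖S x‖ ^ 2 - ‖x‖ ^ 2 := by
  classical
  set w : E := ∑ j, inner ℂ (e j) x • e j with hw
  set y : E := x - w with hy
  have hx : x = w + y := by rw [hy]; abel
  have hey : ∀ j, inner ℂ (e j) y = 0 := by
    intro j
    rw [hy, inner_sub_right, hw, he.inner_right_fintype, sub_self]
  have heSy : ∀ j, inner ℂ (e j) (S y) = 0 := by
    intro j
    rw [← hS, hSe, inner_smul_left, hey, mul_zero]
  have pyth : ∀ (d : J → ℂ) (z : E), (∀ j, inner ℂ (e j) z = 0) →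
      ‖(∑ j, d j • e j) + z‖ ^ 2 = ∑ j, ‖d j‖ ^ 2 + ‖z‖ ^ 2 := by
    intro d z hz
    have h0 : inner ℂ (∑ j, d j • e j) z = 0 := by
      rw [sum_inner]
      exact Finset.sum_eq_zero fun j _ => by rw [inner_smul_left, hz, mul_zero]
    have h1 := norm_add_sq_eq_norm_sq_add_norm_sq_of_inner_eq_zero _ _ h0
    have h2 : ‖∑ j, d j • e j‖ ^ 2 = ∑ j, ‖d j‖ ^ 2 := by
      have h3 := he.inner_sum d d Finset.univ
      rw [inner_self_eq_norm_sq_to_K] at h3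
      have h4 : ∀ z : ℂ, (starRingEnd ℂ) z * z = ((‖z‖^2 : ℝ) : ℂ) := by
        intro z; rw [mul_comm, Complex.mul_conj']; push_cast; rfl
      simp only [h4] at h3
      apply Complex.ofReal_injective
      push_cast at h3 ⊢
      exact h3
    rw [← h2, sq, sq, sq]; exact h1
  have hSx : S x = ∑ j, ((c j : ℂ) * inner ℂ (e j) x) • e j + S y := by
    nth_rewrite 1 [hx]
    rw [map_add, hw, map_sum]
    congr 1
    refine Finset.sum_congr rfl fun j _ => ?_
    rw [map_smul, hSe, smul_smul, mul_comm]
  have n1 := pyth (fun j => inner ℂ (e j) x) y hey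
  rw [← hw, ← hx] at n1
  have n2 := pyth (fun j => (c j : ℂ) * inner ℂ (e j) x) (S y) heSy
  rw [← hSx] at n2
  rw [n1, n2]
  have h5 : ∀ j, ‖(c j : ℂ) * inner ℂ (e j) x‖ ^ 2 = c j ^ 2 * ‖inner ℂ (e j) x‖ ^ 2 := by
    intro j; rw [norm_mul, mul_pow, Complex.norm_real, Real.norm_eq_abs, sq_abs]
  simp only [h5, sub_mul, one_mul, Finset.sum_sub_distrib]
  linarith [hgap y]

theorem aux_trace_rank {ι : Type*} [Fintype ι] [DecidableEq ι] (P : Matrix ι ι ℂ)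
    (h : P * P = P) : P.trace = (P.rank : ℂ) := by
  have hi : IsIdempotentElem (Matrix.toLin' P) := by
    unfold IsIdempotentElem
    rw [Module.End.mul_eq_comp, ← Matrix.toLin'_mul, h]
  have := (LinearMap.IsIdempotentElem.isProj_range _ hi).trace
  rw [Matrix.trace_toLin'_eq] at this
  rw [this]; rfl

theorem aux_sum_sym {N : ℕ} (f : Fin N → Fin N → ℝ) (hf : ∀ a b, f a b = f b a) :
    ∑ a, ∑ b, f a b = ∑ a, f a a + 2 * ∑ p : {p : Fin N × Fin N // p.1 < p.2}, f p.1.1 p.1.2 := by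
  have h1 : ∑ p : {p : Fin N × Fin N // p.1 < p.2}, f p.1.1 p.1.2
      = ∑ a, ∑ b, if a < b then f a b else 0 := by
    rw [← Finset.sum_subtype (Finset.univ.filter fun p : Fin N × Fin N => p.1 < p.2)
      (by simp) (fun p => f p.1 p.2), Finset.sum_filter, Fintype.sum_prod_type]
  have h2 : ∑ p : {p : Fin N × Fin N // p.1 < p.2}, f p.1.1 p.1.2
      = ∑ a, ∑ b, if b < a then f a b else 0 := by
    rw [h1, Finset.sum_comm]
    simp only [hf]
  have h3 : ∀ a b, f a b = (if a = b then f a b else 0) + (if a < b then f a b else 0)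
      + (if b < a then f a b else 0) := by
    intro a b
    rcases lt_trichotomy a b with h | h | h
    · simp [h, h.ne, h.not_gt]
    · simp [h]
    · simp [h, h.ne', h.not_gt]
  rw [two_mul]
  nth_rewrite 1 [h1]
  rw [h2]
  calc ∑ a, ∑ b, f a b = ∑ a, ∑ b, ((if a = b then f a b else 0) + (if a < b then f a b else 0)
      + (if b < a then f a b else 0)) := by
        refine Finset.sum_congr rfl fun a _ => Finset.sum_congr rfl fun b _ => h3 a b
    _ = _ := by
      simp only [Finset.sum_add_distrib, Finset.sum_ite_eq, Finset.mem_univ, if_true]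
      ring

abbrev PairIdx (N : ℕ) := {p : Fin N × Fin N // p.1 < p.2}

def sgnC {N : ℕ} (j : Option (PairIdx N)) (a : Fin N) : ℝ :=
  match j with
  | none => 1
  | some p => 1 - 2 * (if a = p.1.1 then 1 else 0) - 2 * (if a = p.1.2 then 1 else 0)

theorem sgnC_inj {N : ℕ} (j j' : Option (PairIdx N)) (h : ∀ a, sgnC j a = sgnC j' a) : j = j' := by
  rcases j with _ | ⟨⟨a, b⟩, hab⟩ <;> rcases j' with _ | ⟨⟨c, d⟩, hcd⟩
  · rfl
  · have := h c
    simp only at hcd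
    simp only [sgnC, hcd.ne, if_true, if_false] at this
    norm_num at this
  · have := h a
    simp only at hab
    simp [sgnC, hab.ne] at this
  · simp only at hab hcd
    have h1 := h a
    have h2 := h b
    simp only [sgnC, hab.ne, hab.ne', if_true, if_false] at h1 h2
    have ha : a = c ∨ a = d := by
      by_contra hh; push Not at hh; simp [hh.1, hh.2] at h1
    have hb : b = c ∨ b = d := by
      by_contra hh; push Not at hh; simp [hh.1, hh.2] at h2
    have : a = c ∧ b = d := by
      rcases ha with ha | ha <;> rcases hb with hb | hb <;> grind
    simp [this.1, this.2]

def cliffE {N : ℕ} {ι : Type*} [Fintype ι] [DecidableEq ι] (U : Fin N → Matrix ι ι ℂ)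
    (j : Option (PairIdx N)) : Matrix ι ι ℂ :=
  match j with
  | none => 1
  | some p => U p.1.1 * U p.1.2

theorem cliffE_conj {N : ℕ} {ι : Type*} [Fintype ι] [DecidableEq ι] (U : Fin N → Matrix ι ι ℂ)
    (h2 : ∀ a, U a * U a = 1) (hanti : ∀ a b, a ≠ b → U a * U b = -(U b * U a))
    (j : Option (PairIdx N)) (a : Fin N) :
    U a * cliffE U j * U a = (sgnC j a : ℂ) • cliffE U j := by
  rcases j with _ | ⟨⟨b, c⟩, hbc⟩
  · simp [cliffE, sgnC, h2]
  · simp only at hbc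
    simp only [cliffE, sgnC]
    by_cases hb : a = b
    · subst hb
      simp only [hbc.ne, if_true, if_false]
      rw [← mul_assoc, h2, one_mul, hanti _ _ hbc.ne']
      norm_num
    · by_cases hc : a = c
      · subst hc
        simp only [hbc.ne', if_true, if_false]
        rw [mul_assoc, mul_assoc, h2, mul_one, hanti _ _ hbc.ne']
        norm_num
      · simp only [hb, hc, if_false]
        rw [mul_assoc, mul_assoc, hanti c a (Ne.symm hc), mul_neg, mul_neg, ← mul_assoc, ← mul_assoc,
          hanti a b hb, neg_mul, neg_mul, neg_neg, mul_assoc (U b), h2 a]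
        simp

open scoped ComplexOrder in
theorem clifford_bound {ι : Type*} [Fintype ι] [DecidableEq ι] [Nonempty ι] (n : ℕ)
    (U : Fin (2 * n + 1) → Matrix ι ι ℂ) (hH : ∀ a, (U a)ᴴ = U a)
    (h2 : ∀ a, U a * U a = 1) (hanti : ∀ a b, a ≠ b → U a * U b = -(U b * U a))
    (P : Matrix ι ι ℂ) (hPherm : Pᴴ = P) (hPidem : P * P = P)
    (hdet : ∀ p : PairIdx (2 * n + 1), ∃ ε : ℂ, P * (U p.1.1 * U p.1.2) * P = ε • P) :
    ∃ E : ℝ, 0 ≤ E ∧ (P.rank : ℝ) ^ 2 * (2 * n * (n + 1) + 2 * (n - 1) * (n - 2) * E) ≤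
      Fintype.card ι * ((P.rank : ℝ) * (E + n)) := by
  classical
  let i1 : NormedAddCommGroup (Matrix ι ι ℂ) :=
    Matrix.toMatrixNormedAddCommGroup (1 : Matrix ι ι ℂ) Matrix.PosDef.one
  let i2 : InnerProductSpace ℂ (Matrix ι ι ℂ) :=
    Matrix.toMatrixInnerProductSpace (1 : Matrix ι ι ℂ) Matrix.PosDef.one.posSemidef
  have hinner : ∀ X Y : Matrix ι ι ℂ, inner ℂ X Y = (Y * Xᴴ).trace := by
    intro X Y
    have : inner ℂ X Y = (Y * 1 * Xᴴ).trace := rfl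
    rw [this, mul_one]
  set D : ℝ := (Fintype.card ι : ℝ) with hD
  have hDpos : 0 < D := by rw [hD]; exact_mod_cast Fintype.card_pos
  set r : ℝ := (P.rank : ℝ) with hr
  have htr : P.trace = (r : ℂ) := by rw [aux_trace_rank P hPidem, hr]; simp
  choose ε hε using hdet
  let C : Fin (2 * n + 1) → Matrix ι ι ℂ →ₗ[ℂ] Matrix ι ι ℂ := fun a =>
    (LinearMap.mulLeft ℂ (U a)).comp (LinearMap.mulRight ℂ (U a))
  have hC : ∀ a X, C a X = U a * X * U a := by
    intro a X; simp [C, mul_assoc]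
  have hsym : ∀ a, (C a).IsSymmetric := by
    intro a X Y
    rw [hinner, hinner, hC, hC]
    simp only [conjTranspose_mul, hH]
    rw [mul_assoc (U a * Y), mul_assoc (U a), Matrix.trace_mul_comm (U a)]
    simp only [mul_assoc]
  have hinv : ∀ a X, C a (C a X) = X := by
    intro a X
    rw [hC, hC, ← mul_assoc, ← mul_assoc, h2, one_mul, mul_assoc, h2, mul_one]
  have hCC : ∀ a b X, C a (C b X) = (U a * U b) * X * (U b * U a) := by
    intro a b X
    rw [hC, hC]; simp only [mul_assoc]
  have hcomm : ∀ a b X, C a (C b X) = C b (C a X) := by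
    intro a b X
    by_cases hab : a = b
    · rw [hab]
    · rw [hCC, hCC, hanti a b hab, hanti b a (Ne.symm hab)]
      simp
  let S : Matrix ι ι ℂ →ₗ[ℂ] Matrix ι ι ℂ := ∑ a, C a
  have hS : ∀ X, S X = ∑ a, C a X := by intro X; simp [S]
  have hSsym : S.IsSymmetric := by
    intro X Y
    rw [hS, hS, sum_inner, inner_sum]
    exact Finset.sum_congr rfl fun a _ => hsym a X Y
  have hgap : ∀ X, ‖X‖ ^ 2 ≤ ‖S X‖ ^ 2 := by
    intro X
    have := aux_gap C hsym hinv hcomm Finset.univ 0 (by simp) X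
    rw [hS]
    simpa using this
  let e : Option (PairIdx (2 * n + 1)) → Matrix ι ι ℂ := fun j =>
    ((1 / √D : ℝ) : ℂ) • cliffE U j
  have hCe : ∀ a j, C a (cliffE U j) = (sgnC j a : ℂ) • cliffE U j := by
    intro a j
    rw [hC, cliffE_conj U h2 hanti]
  have hunit : ∀ j, cliffE U j * (cliffE U j)ᴴ = 1 := by
    intro j
    rcases j with _ | p
    · simp [cliffE]
    · simp only [cliffE, conjTranspose_mul, hH]
      rw [mul_assoc, ← mul_assoc (U p.1.2), h2, one_mul, h2]
  have hon : Orthonormal ℂ e := by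
    rw [orthonormal_iff_ite]
    intro i j
    simp only [e, inner_smul_left, inner_smul_right]
    by_cases hij : i = j
    · subst hij
      rw [if_pos rfl, hinner, hunit, Matrix.trace_one, Complex.conj_ofReal]
      have hs : √D * √D = D := Real.mul_self_sqrt hDpos.le
      have : (1 / √D) * ((1 / √D) * D) = 1 := by
        have : √D ≠ 0 := (Real.sqrt_pos.2 hDpos).ne'
        field_simp
        linarith
      have h' : ((1 / √D : ℝ) : ℂ) * (((1 / √D : ℝ) : ℂ) * ((D : ℝ) : ℂ)) = 1 := by
        exact_mod_cast this
      rw [← h', hD]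
      push_cast
      rfl
    · rw [if_neg hij]
      have hex : ∃ a, sgnC i a ≠ sgnC j a := by
        by_contra hh; push Not at hh
        exact hij (sgnC_inj i j hh)
      obtain ⟨a, ha⟩ := hex
      have h := hsym a (cliffE U i) (cliffE U j)
      rw [hCe, hCe, inner_smul_left, inner_smul_right, Complex.conj_ofReal] at h
      have h0 : inner ℂ (cliffE U i) (cliffE U j) = 0 := by
        have h3 : ((sgnC i a : ℂ) - sgnC j a) * inner ℂ (cliffE U i) (cliffE U j) = 0 := by
          linear_combination h
        rcases mul_eq_zero.1 h3 with h4 | h4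
        · exact absurd (by exact_mod_cast sub_eq_zero.1 h4) ha
        · exact h4
      rw [h0]; simp
  have hSe : ∀ j, S (e j) = ((∑ a, sgnC j a : ℝ) : ℂ) • e j := by
    intro j
    simp only [e, map_smul, hS, hCe]
    rw [← Finset.smul_sum, ← Finset.sum_smul, smul_comm]
    push_cast
    rfl
  have key := aux_bessel S hSsym hgap e hon (fun j => ∑ a, sgnC j a) hSe P
  have hPP : ‖P‖ ^ 2 = r := by
    apply Complex.ofReal_injective
    have := inner_self_eq_norm_sq_to_K (𝕜 := ℂ) P
    rw [hinner, hPherm, hPidem, htr] at this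
    rw [this]; push_cast; rfl
  have htrp : ∀ p : PairIdx (2 * n + 1), (P * (U p.1.1 * U p.1.2)).trace = ε p * r := by
    intro p
    have := congrArg Matrix.trace (hε p)
    rw [Matrix.trace_mul_comm, ← mul_assoc, hPidem, Matrix.trace_smul, htr] at this
    simpa using this
  have htrp' : ∀ p : PairIdx (2 * n + 1),
      (P * (U p.1.2 * U p.1.1)).trace = (starRingEnd ℂ) (ε p) * r := by
    intro p
    have := congrArg star (htrp p)
    rw [← Matrix.trace_conjTranspose] at this
    simp only [conjTranspose_mul, hH, hPherm] at this
    rw [Matrix.trace_mul_comm] at this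
    rw [this]; simp
  have hnone : ‖inner ℂ (e none) P‖ ^ 2 = r ^ 2 / D := by
    simp only [e, inner_smul_left]
    rw [hinner]
    simp only [cliffE]
    rw [conjTranspose_one, mul_one, htr, Complex.conj_ofReal, ← Complex.ofReal_mul,
      Complex.norm_real, Real.norm_eq_abs, sq_abs, mul_pow, div_pow, Real.sq_sqrt hDpos.le]
    ring
  have hsome : ∀ p, ‖inner ℂ (e (some p)) P‖ ^ 2 = ‖ε p‖ ^ 2 * r ^ 2 / D := by
    intro p
    simp only [e, inner_smul_left]
    rw [hinner]
    simp only [cliffE, conjTranspose_mul, hH]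
    rw [htrp', norm_mul, norm_mul, Complex.conj_ofReal, RCLike.norm_conj,
      Complex.norm_real, Complex.norm_real, Real.norm_eq_abs, Real.norm_eq_abs, mul_pow, mul_pow,
      sq_abs, sq_abs, div_pow, Real.sq_sqrt hDpos.le]
    ring
  have cnone : ∑ a, sgnC (none : Option (PairIdx (2 * n + 1))) a = 2 * n + 1 := by
    simp [sgnC]
  have csome : ∀ p : PairIdx (2 * n + 1), ∑ a, sgnC (some p) a = 2 * n - 3 := by
    intro p
    simp only [sgnC, Finset.sum_sub_distrib, ← Finset.mul_sum]
    simp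
    ring
  -- the left-hand quadratic form
  let f : Fin (2 * n + 1) → Fin (2 * n + 1) → ℝ := fun a b => (inner ℂ P (C a (C b P))).re
  have hSP : ‖S P‖ ^ 2 = ∑ a, ∑ b, f a b := by
    have h1 : inner ℂ (S P) (S P) = ∑ a, ∑ b, inner ℂ P (C a (C b P)) := by
      rw [hSsym, hS, hS, inner_sum]
      refine Finset.sum_congr rfl fun a _ => ?_
      rw [map_sum, inner_sum]
    have h3 := inner_self_eq_norm_sq_to_K (𝕜 := ℂ) (S P)
    rw [h1] at h3
    have h4 := congrArg Complex.re h3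
    simp only [Complex.re_sum] at h4
    simp only [f]
    rw [h4]
    have : ((RCLike.ofReal ‖S P‖ : ℂ)) ^ 2 = ((‖S P‖ ^ 2 : ℝ) : ℂ) := by push_cast; rfl
    rw [this, Complex.ofReal_re]
  have hfsym : ∀ a b, f a b = f b a := by
    intro a b; simp only [f]; rw [hcomm]
  have hfd : ∀ a, f a a = r := by
    intro a; simp only [f]; rw [hinv, hinner, hPherm, hPidem, htr, Complex.ofReal_re]
  have hfp : ∀ p : PairIdx (2 * n + 1), f p.1.1 p.1.2 = ‖ε p‖ ^ 2 * r := by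
    intro p
    simp only [f]
    rw [hCC, hinner, hPherm]
    have : (U p.1.1 * U p.1.2 * P * (U p.1.2 * U p.1.1) * P).trace
        = ((‖ε p‖ ^ 2 * r : ℝ) : ℂ) := by
      rw [Matrix.trace_mul_comm, ← mul_assoc, ← mul_assoc P, hε, smul_mul_assoc, Matrix.trace_smul,
        htrp', smul_eq_mul, ← mul_assoc, Complex.mul_conj']
      push_cast; rfl
    rw [this, Complex.ofReal_re]
  rw [hSP, aux_sum_sym f hfsym, hPP, Fintype.sum_option, hnone, cnone] at key
  simp only [hsome, csome, hfd, hfp] at key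
  refine ⟨∑ p, ‖ε p‖ ^ 2, Finset.sum_nonneg fun p _ => sq_nonneg _, ?_⟩
  rw [← Finset.mul_sum, ← Finset.sum_div, ← Finset.sum_mul, ← Finset.sum_mul] at key
  set E := ∑ p, ‖ε p‖ ^ 2
  simp only [Finset.sum_const, Finset.card_univ, Fintype.card_fin, nsmul_eq_mul] at key
  push_cast at key
  have k2 := mul_le_mul_of_nonneg_left key hDpos.le
  have k3 : D * (((2 * n + 1 : ℝ) ^ 2 - 1) * (r ^ 2 / D) + ((2 * n - 3) ^ 2 - 1) * (E * r ^ 2 / D))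
      = 2 * (r ^ 2 * (2 * n * (n + 1) + 2 * (n - 1) * (n - 2) * E)) := by
    field_simp
    ring
  rw [k3] at k2
  nlinarith [k2]

/-- Distance-2 bound for the `𝔰𝔬(2n+1)` spinorial quantum metric: if a nonzero
orthogonal projection `P` on `(ℂ²)^{⊗n}` detects every `Γ_x` with `x ∈ F₂^{2n+1}` of
weight `2`, then `(n+1) · rank P ≤ 2^{n−1}`. -/
theorem spinorial_distance_two_bound (n : ℕ) (hn : 3 ≤ n)
    (P : Matrix (Fin n → Fin 2) (Fin n → Fin 2) ℂ)
    (hPherm : Pᴴ = P) (hPidem : P * P = P) (hPne : P ≠ 0)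
    (hdet : ∀ x : Fin (2 * n + 1) → ZMod 2, wtZ x = 2 →
      ∃ ε : ℂ, P * gammaOp n (2 * n + 1) x * P = ε • P) :
    (n + 1) * P.rank ≤ 2 ^ (n - 1) := by
  classical
  have hr : 0 < P.rank := by
    rw [Nat.pos_iff_ne_zero]
    intro h
    have ht := aux_trace_rank P hPidem
    rw [h, Nat.cast_zero] at ht
    apply hPne
    have h0 : (Pᴴ * P).trace = 0 := by rw [hPherm, hPidem, ht]
    open scoped ComplexOrder in
    exact Matrix.trace_conjTranspose_mul_self_eq_zero_iff.1 h0
  obtain ⟨E, hE, h⟩ := clifford_bound n (fun a : Fin (2 * n + 1) => weylBrauer n ((a : ℕ) + 1))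
    (fun a => wb_herm n _) (fun a => wb_sq n _)
    (fun a b hab => wb_anti n a b a.2 b.2 (fun h => hab (Fin.ext h))) P hPherm hPidem (by
      intro p
      obtain ⟨x, c, hx, hc⟩ := gamma_pair n p.1.1 p.1.2 p.2
      obtain ⟨ε, hε⟩ := hdet x hx
      refine ⟨c * ε, ?_⟩
      rw [hc, mul_smul_comm, smul_mul_assoc, hε, smul_smul])
  refine final_arith n P.rank E hn hE hr ?_
  have hcard : (Fintype.card (Fin n → Fin 2) : ℝ) = 2 ^ n := by simp
  rw [hcard] at h
  exact h

end
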